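/- Let T be a tree on n vertices and A a real symmetric matrix with graph T, and suppose P_1, …, P_k are pairwise vertex-disjoint paths in T covering n−t vertices of T. Then the determinantal divisor Δ_{n−k}(xI−A) divides det((xI−A)[T ∖ (P_1 ∪ ⋯ ∪ P_k)]) and deg Δ_{n−k}(xI−A) ≤ t. Moreover, if λ is an eigenvalue of A with m_A(λ) ≥ k+1, then λ is an eigenvalue of the principal submatrix A[T ∖ (P_1 ∪ ⋯ ∪ P_k)] with multiplicity at least m_A(λ) − k. -/

import Mathlib

open Polynomial Matrix

/-- The graph of a square matrix `M`: vertices are the indices, with an edge `u v`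
(for `u ≠ v`) exactly when the corresponding entry is nonzero. -/
def graphOf {V R : Type*} [Zero R] (M : Matrix V V R) : SimpleGraph V :=
  SimpleGraph.fromRel (fun u v => M u v ≠ 0)

/-- The `k`-th determinantal divisor of a matrix over `ℝ[x]`: the monic (normalized)
greatest common divisor of all `k × k` minors (`Δ_0 = 1`). -/
noncomputable def detDivisor {n : ℕ} (M : Matrix (Fin n) (Fin n) (Polynomial ℝ)) (k : ℕ) :
    Polynomial ℝ :=
  (Finset.univ : Finset ((Fin k → Fin n) × (Fin k → Fin n))).gcd
    fun p => (M.submatrix p.1 p.2).det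

lemma aux_gcd {n : ℕ} (M : Matrix (Fin n) (Fin n) ℝ[X]) (k : ℕ) (f g : Fin k → Fin n) :
    detDivisor M k ∣ (M.submatrix f g).det := by
  unfold detDivisor
  exact Finset.gcd_dvd (f := fun p : (Fin k → Fin n) × (Fin k → Fin n) =>
      (M.submatrix p.1 p.2).det) (Finset.mem_univ (f, g))

lemma aux_rank {n : ℕ} (A : Matrix (Fin n) (Fin n) ℝ) (hA : A.IsSymm) (lam : ℝ) :
    (Matrix.scalar (Fin n) lam - A).rank + A.charpoly.rootMultiplicity lam ≤ n := by
  have hH : A.IsHermitian := by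
    rw [Matrix.IsHermitian, Matrix.conjTranspose_eq_transpose_of_trivial]; exact hA
  set e := hH.eigenvalues with he
  have h1 : A.charpoly.rootMultiplicity lam = Fintype.card {i // ¬ (lam - e i ≠ 0)} := by
    rw [← Polynomial.count_roots, hH.roots_charpoly_eq_eigenvalues, Multiset.count_map,
      Fintype.card_subtype, Finset.card_def]
    simp [sub_eq_zero, he, Finset.filter_val]
  have h2 : (Matrix.scalar (Fin n) lam - A).rank ≤ Fintype.card {i // lam - e i ≠ 0} := by
    rw [← Matrix.rank_diagonal]
    have h3 : Matrix.scalar (Fin n) lam - A = (hH.eigenvectorUnitary : Matrix (Fin n) (Fin n) ℝ) *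
        Matrix.diagonal (fun i => lam - e i) *
        star (hH.eigenvectorUnitary : Matrix (Fin n) (Fin n) ℝ) := by
      have h4 := hH.spectral_theorem
      rw [Unitary.conjStarAlgAut_apply] at h4
      have h5 : Matrix.diagonal (fun i => lam - e i) =
          Matrix.scalar (Fin n) lam - Matrix.diagonal (RCLike.ofReal ∘ hH.eigenvalues) := by
        ext a b
        by_cases hab : a = b
        · subst hab; simp [he]
        · simp [hab]
      rw [h5, mul_sub, sub_mul, ← h4, ← (Matrix.scalar_commute lam (fun r' => mul_comm _ _) _).eq,
        mul_assoc]
      simp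
    rw [h3]
    exact (Matrix.rank_mul_le_left _ _).trans (Matrix.rank_mul_le_right _ _)
  have h6 := Fintype.card_subtype_compl (fun i => lam - e i ≠ 0)
  have h7 := Fintype.card_subtype_le (fun i => lam - e i ≠ 0)
  simp only [Fintype.card_fin] at h6 h7
  omega

lemma aux_dvd_det {S : Type*} [Fintype S] [DecidableEq S] (B : Matrix S S ℝ[X]) (lam : ℝ) (r : ℕ)
    (h : (B.map (Polynomial.eval lam)).rank + r ≤ Fintype.card S) :
    (X - C lam) ^ r ∣ B.det := by
  obtain ⟨L, L', D, hD⟩ :=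
    Matrix.Pivot.exists_list_transvec_mul_mul_list_transvec_eq_diagonal (B.map (Polynomial.eval lam))
  set P := (L.map Matrix.TransvectionStruct.toMatrix).prod with hP
  set Q := (L'.map Matrix.TransvectionStruct.toMatrix).prod with hQ
  have hPd : P.det = 1 := Matrix.TransvectionStruct.det_toMatrix_prod L
  have hQd : Q.det = 1 := Matrix.TransvectionStruct.det_toMatrix_prod L'
  have hr : Fintype.card {i // D i ≠ 0} ≤ (B.map (Polynomial.eval lam)).rank := by
    rw [← Matrix.rank_diagonal, ← hD]
    exact (Matrix.rank_mul_le_left _ _).trans (Matrix.rank_mul_le_right _ _)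
  have hc := Fintype.card_subtype_compl (fun i => D i ≠ 0)
  have hc2 := Fintype.card_subtype_le (fun i => D i ≠ 0)
  set N := P.map C * B * Q.map C with hN
  have hdet : N.det = B.det := by
    have a1 : (P.map (C : ℝ →+* ℝ[X])).det = 1 := by
      have := (RingHom.map_det (C : ℝ →+* ℝ[X]) P).symm
      rw [hPd, map_one] at this; exact this
    have a2 : (Q.map (C : ℝ →+* ℝ[X])).det = 1 := by
      have := (RingHom.map_det (C : ℝ →+* ℝ[X]) Q).symm
      rw [hQd, map_one] at this; exact this
    rw [hN, Matrix.det_mul, Matrix.det_mul, a1, a2, one_mul, mul_one]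
  have hNe : N.map (Polynomial.evalRingHom lam) = Matrix.diagonal D := by
    rw [← hD, hN, Matrix.map_mul, Matrix.map_mul]
    congr 1
    · congr 1
      ext a b; simp
    · ext a b; simp
  have hcol : ∀ a b, D b = 0 → (X - C lam) ∣ N a b := by
    intro a b hb
    rw [Polynomial.dvd_iff_isRoot, Polynomial.IsRoot.def]
    have := congrFun (congrFun hNe a) b
    simp only [Matrix.map_apply, Polynomial.coe_evalRingHom] at this
    rw [this]
    by_cases hab : a = b
    · subst hab; simpa using hb
    · simp [hab]
  rw [← hdet, Matrix.det_apply]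
  refine Finset.dvd_sum fun π _ => ?_
  refine Dvd.dvd.trans ?_ (dvd_of_eq (Units.smul_def _ _).symm)
  rw [zsmul_eq_mul]
  refine Dvd.dvd.mul_left ?_ _
  have h1 : (X - C lam) ^ r ∣ ∏ b ∈ Finset.univ.filter (fun b => D b = 0), (X - C lam) := by
    rw [Finset.prod_const]
    apply pow_dvd_pow
    have : Fintype.card {i // ¬ (D i ≠ 0)} = (Finset.univ.filter (fun b => D b = 0)).card := by
      rw [Fintype.card_subtype]; simp
    omega
  refine h1.trans ?_
  refine (Finset.prod_dvd_prod_of_dvd _ (fun b => N (π b) b) ?_).trans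
    (Finset.prod_dvd_prod_of_subset _ _ _ (Finset.filter_subset _ _))
  intro b hb
  exact hcol _ _ (Finset.mem_filter.mp hb).2

lemma aux_rank_submatrix {n : ℕ} {S : Type*} [Fintype S] [DecidableEq S]
    (M : Matrix (Fin n) (Fin n) ℝ) (f g : S → Fin n) :
    (M.submatrix f g).rank ≤ M.rank := by
  have : M.submatrix f g = (1 : Matrix (Fin n) (Fin n) ℝ).submatrix f id * M *
      (1 : Matrix (Fin n) (Fin n) ℝ).submatrix id g := by
    ext a b
    simp [Matrix.mul_apply, Matrix.one_apply]
  rw [this]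
  exact (Matrix.rank_mul_le_left _ _).trans (Matrix.rank_mul_le_right _ _)

/-- The forcing argument. -/
lemma aux_forced {V : Type*} [Fintype V] [DecidableEq V] (G : SimpleGraph V) (hG : G.IsAcyclic)
    (S : Type*) [Fintype S] [DecidableEq S] (ι τ : S → V)
    (hτi : Function.Injective τ)
    (hι : Function.Injective ι)
    (hadj : ∀ v, τ v = ι v ∨ G.Adj (ι v) (τ v))
    (h2 : ∀ v u, τ v ≠ ι v → τ v = ι u → τ u ≠ ι v)
    (π : Equiv.Perm S) (hπ : ∀ v, ι (π v) = τ v ∨ G.Adj (ι (π v)) (τ v))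
    (q : S) (hq : τ q ≠ ι q) : π q = q := by
  classical
  have hadjq : G.Adj (ι q) (τ q) := (hadj q).resolve_left hq
  have hbr : ¬ (G.deleteEdges {s(ι q, τ q)}).Reachable (ι q) (τ q) := by
    have := SimpleGraph.isAcyclic_iff_forall_adj_isBridge.mp hG hadjq
    rwa [SimpleGraph.isBridge_iff] at this
  set c : V → Prop := fun v => (G.deleteEdges {s(ι q, τ q)}).Reachable v (τ q) with hc
  have hcross : ∀ a b, G.Adj a b → c a → ¬ c b → a = τ q ∧ b = ι q := by
    intro a b hab ha hb
    have hmem : s(a, b) = s(ι q, τ q) := by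
      by_contra hne
      apply hb
      have : (G.deleteEdges {s(ι q, τ q)}).Adj b a := by
        rw [SimpleGraph.deleteEdges_adj]
        exact ⟨hab.symm, fun h => hne (Sym2.eq_swap.trans (Set.mem_singleton_iff.mp h))⟩
      exact this.reachable.trans ha
    rcases Sym2.eq_iff.mp hmem with ⟨h1, h2⟩ | ⟨h1, h2⟩
    · subst h1; exact absurd ha hbr
    · exact ⟨h1, h2⟩
  have hcτ : c (τ q) := SimpleGraph.Reachable.refl _
  -- counting
  have hlt : (Finset.univ.filter (fun v => c (ι v))).card <
      (Finset.univ.filter (fun v => c (τ v))).card := by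
    apply Finset.card_lt_card
    rw [Finset.ssubset_iff_of_subset]
    · exact ⟨q, by simp [hcτ], by simpa using hbr⟩
    · intro v hv
      simp only [Finset.mem_filter, Finset.mem_univ, true_and] at hv ⊢
      by_contra hn
      rcases hadj v with h | h
      · rw [h] at hn; exact hn hv
      · obtain ⟨h3, h4⟩ := hcross _ _ h hv hn
        exact h2 q v hq h3.symm h4
  have heq : (Finset.univ.filter (fun v => c (ι (π v)))).card =
      (Finset.univ.filter (fun v => c (ι v))).card := by
    apply Finset.card_bij (fun v _ => π v)
    · intro a ha; simpa using ha
    · intro a _ b _ h; exact π.injective h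
    · intro b hb; exact ⟨π.symm b, by simpa using hb, by simp⟩
  rw [← heq] at hlt
  obtain ⟨v, hv1, hv2⟩ := Finset.exists_mem_notMem_of_card_lt_card hlt
  simp only [Finset.mem_filter, Finset.mem_univ, true_and] at hv1 hv2
  rcases hπ v with h | h
  · rw [h] at hv2; exact absurd hv1 hv2
  · obtain ⟨h3, h4⟩ := hcross _ _ h.symm hv1 hv2
    have := hτi h3
    subst this
    exact hι h4

/-- Determinant of a matrix whose nonvanishing Leibniz terms all fix the complement of `p`. -/
lemma aux_det {S R : Type*} [Fintype S] [DecidableEq S] [CommRing R] (B : Matrix S S R)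
    (p : S → Prop) [DecidablePred p]
    (h : ∀ π : Equiv.Perm S, (∀ v, B (π v) v ≠ 0) → ∀ v, ¬ p v → π v = v) :
    B.det = (B.toSquareBlockProp p).det * ∏ v : {v // ¬ p v}, B v v := by
  set B' : Matrix S S R := Matrix.of fun u v => if ¬ p v ∧ u ≠ v then 0 else B u v with hB'
  have h1 : B.det = B'.det := by
    rw [Matrix.det_apply, Matrix.det_apply]
    refine Finset.sum_congr rfl fun π _ => ?_
    congr 1
    by_cases hz : ∀ v, B (π v) v ≠ 0
    · refine Finset.prod_congr rfl fun v _ => ?_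
      rw [hB', Matrix.of_apply, if_neg]
      rintro ⟨a, b⟩
      exact b (h π hz v a)
    · push Not at hz
      obtain ⟨v, hv⟩ := hz
      have e1 : ∏ x, B (π x) x = 0 := Finset.prod_eq_zero (Finset.mem_univ v) hv
      have e2 : ∏ x, B' (π x) x = 0 := by
        refine Finset.prod_eq_zero (Finset.mem_univ v) ?_
        rw [hB', Matrix.of_apply, hv, ite_self]
      rw [e1, e2]
  rw [h1, Matrix.twoBlockTriangular_det' B' p]
  · congr 1
    · congr 1
      ext a b
      simp [hB', Matrix.toSquareBlockProp_def, b.2]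
    · rw [← Matrix.det_diagonal]
      congr 1
      ext a b
      by_cases hab : a = b
      · subst hab; simp [hB', Matrix.toSquareBlockProp_def]
      · have : (a : S) ≠ b := fun h => hab (Subtype.ext h)
        simp [hB', Matrix.toSquareBlockProp_def, hab, this, b.2]
  · intro a ha b hb
    have : a ≠ b := by rintro rfl; exact hb ha
    simp [hB', hb, this]

set_option maxHeartbeats 1000000 in
/-- Let `A` be an `n × n` real symmetric matrix whose graph is a tree `T`, and let
`P_1, …, P_k` be pairwise vertex-disjoint paths in `T` covering `n - t` vertices (`t ≤ n`).
Then `Δ_{n-k}(xI - A)` divides the characteristic-matrix determinant of the principal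
submatrix on the uncovered vertices, `deg Δ_{n-k}(xI - A) ≤ t`, and every eigenvalue `λ` of
`A` with `m_A(λ) ≥ k + 1` is an eigenvalue of the principal submatrix of `A` on the
uncovered vertices with multiplicity at least `m_A(λ) - k`. -/
theorem detDivisor_dvd_of_disjoint_paths {n : ℕ} (A : Matrix (Fin n) (Fin n) ℝ)
    (hA : A.IsSymm) (hT : (graphOf A).IsTree)
    (k : ℕ) (i j : Fin k → Fin n)
    (w : ∀ s : Fin k, (graphOf A).Walk (i s) (j s))
    (hpath : ∀ s, (w s).IsPath)
    (hdisj : ∀ s t : Fin k, s ≠ t → ∀ v : Fin n,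
      v ∈ (w s).support → v ∉ (w t).support)
    (t : ℕ) (ht : t ≤ n)
    (hcover : (Finset.univ.biUnion (fun s : Fin k => (w s).support.toFinset)).card = n - t) :
    (detDivisor (charmatrix A) (n - k) ∣
      ((charmatrix A).submatrix
        (fun a : {v : Fin n // v ∉ Finset.univ.biUnion
            (fun s : Fin k => (w s).support.toFinset)} => (a : Fin n))
        (fun a : {v : Fin n // v ∉ Finset.univ.biUnion
            (fun s : Fin k => (w s).support.toFinset)} => (a : Fin n))).det) ∧
    (detDivisor (charmatrix A) (n - k)).natDegree ≤ t ∧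
    ∀ lam : ℝ, k + 1 ≤ A.charpoly.rootMultiplicity lam →
      A.charpoly.rootMultiplicity lam - k ≤
        (Matrix.charpoly (A.submatrix
          (fun a : {v : Fin n // v ∉ Finset.univ.biUnion
              (fun s : Fin k => (w s).support.toFinset)} => (a : Fin n))
          (fun a : {v : Fin n // v ∉ Finset.univ.biUnion
              (fun s : Fin k => (w s).support.toFinset)} => (a : Fin n)))).rootMultiplicity lam := by
  classical
  set U : Finset (Fin n) := Finset.univ.biUnion (fun s : Fin k => (w s).support.toFinset) with hU
  have hUmem : ∀ v, v ∈ U ↔ ∃ s m, m ≤ (w s).length ∧ (w s).getVert m = v := by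
    intro v
    simp only [hU, Finset.mem_biUnion, Finset.mem_univ, true_and, List.mem_toFinset,
      SimpleGraph.Walk.mem_support_iff_exists_getVert]
    constructor
    · rintro ⟨s, m, h1, h2⟩; exact ⟨s, m, h2, h1⟩
    · rintro ⟨s, m, h1, h2⟩; exact ⟨s, m, h2, h1⟩
  have huniq : ∀ s m s' m', m ≤ (w s).length → m' ≤ (w s').length →
      (w s).getVert m = (w s').getVert m' → s = s' ∧ m = m' := by
    intro s m s' m' hm hm' h
    have hs : s = s' := by
      by_contra hne
      refine hdisj s s' hne ((w s).getVert m) ((w s).getVert_mem_support m) ?_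
      rw [h]; exact (w s').getVert_mem_support m'
    subst hs
    exact ⟨rfl, (hpath s).getVert_injOn hm hm' h⟩
  have hi : Function.Injective i := by
    intro s s' h
    refine (huniq s 0 s' 0 (Nat.zero_le _) (Nat.zero_le _) ?_).1
    simpa using h
  let S := {v : Fin n // v ∉ Finset.univ.image i}
  have hScard : Fintype.card S = n - k := by
    have := Fintype.card_subtype_compl (fun v : Fin n => v ∈ Finset.univ.image i)
    rw [Fintype.card_fin, Fintype.card_coe, Finset.card_image_of_injective _ hi] at this
    rw [Finset.card_univ, Fintype.card_fin] at this
    convert this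
  have hex : ∀ v : S, ∃ u : Fin n, (v.1 ∉ U ∧ u = v.1) ∨
      ∃ s m, m + 1 ≤ (w s).length ∧ (w s).getVert (m + 1) = v.1 ∧ (w s).getVert m = u := by
    rintro ⟨v, hv⟩
    by_cases hvU : v ∈ U
    · obtain ⟨s, m, hm, h⟩ := (hUmem v).mp hvU
      cases m with
      | zero =>
        exfalso; apply hv
        rw [SimpleGraph.Walk.getVert_zero] at h
        exact Finset.mem_image.mpr ⟨s, Finset.mem_univ _, h⟩
      | succ m => exact ⟨_, Or.inr ⟨s, m, hm, h, rfl⟩⟩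
    · exact ⟨v, Or.inl ⟨hvU, rfl⟩⟩
  choose τ hτ using hex
  let ι : S → Fin n := fun v => v.1
  have hι : Function.Injective ι := Subtype.val_injective
  have hτi : Function.Injective τ := by
    intro v v' h
    apply Subtype.ext
    rcases hτ v with ⟨h1, h2⟩ | ⟨s, m, h1, h2, h3⟩ <;>
      rcases hτ v' with ⟨h1', h2'⟩ | ⟨s', m', h1', h2', h3'⟩
    · rw [← h2, ← h2', h]
    · exact absurd ((hUmem _).mpr ⟨s', m', by omega, by rw [h3', ← h, h2]⟩) h1
    · exact absurd ((hUmem _).mpr ⟨s, m, by omega, by rw [h3, h, h2']⟩) h1'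
    · obtain ⟨rfl, rfl⟩ := huniq s m s' m' (by omega) (by omega) (by rw [h3, h3', h])
      rw [← h2, ← h2']
  have hτadj : ∀ v, τ v = ι v ∨ (graphOf A).Adj (ι v) (τ v) := by
    intro v
    rcases hτ v with ⟨h1, h2⟩ | ⟨s, m, h1, h2, h3⟩
    · exact Or.inl h2
    · right
      have := (w s).adj_getVert_succ (i := m) (by omega)
      rw [h2, h3] at this
      exact this.symm
  have hτ2 : ∀ v u, τ v ≠ ι v → τ v = ι u → τ u ≠ ι v := by
    intro v u hne hvu huv
    rcases hτ v with ⟨h1, h2⟩ | ⟨s, m, h1, h2, h3⟩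
    · exact hne h2
    · rcases hτ u with ⟨h1', h2'⟩ | ⟨s', m', h1', h2', h3'⟩
      · exact hne (by rw [hvu, ← huv, h2'])
      · obtain ⟨rfl, h5⟩ := huniq s m s' (m' + 1) (by omega) (by omega) (by rw [h3, h2', hvu])
        obtain ⟨_, h6⟩ := huniq s (m + 1) s m' (by omega) (by omega) (by rw [h2, h3', huv])
        omega
  have hfix : ∀ v : S, τ v = ι v ↔ v.1 ∉ U := by
    intro v
    rcases hτ v with ⟨h1, h2⟩ | ⟨s, m, h1, h2, h3⟩
    · exact ⟨fun _ => h1, fun _ => h2⟩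
    · constructor
      · intro h
        obtain ⟨_, h6⟩ := huniq s (m + 1) s m (by omega) (by omega) (by rw [h2, h3, h])
        omega
      · intro h
        exact absurd ((hUmem _).mpr ⟨s, m + 1, h1, h2⟩) h
  have hiU : ∀ s, i s ∈ U := fun s => (hUmem _).mpr ⟨s, 0, Nat.zero_le _, by simp⟩
  have hadjA : ∀ a b, (graphOf A).Adj a b ↔ a ≠ b ∧ A a b ≠ 0 := by
    intro a b
    simp only [graphOf, SimpleGraph.fromRel_adj]
    rw [hA.apply a b, or_self]
  set B : Matrix S S ℝ[X] := (charmatrix A).submatrix ι τ with hB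
  have hdet := aux_det B (fun v => τ v = ι v) (by
    intro π hπ v hv
    refine aux_forced (graphOf A) hT.2 S ι τ hτi hι hτadj hτ2 π ?_ v hv
    intro u
    by_cases he : ι (π u) = τ u
    · exact Or.inl he
    · right
      have h1 := hπ u
      rw [hB, Matrix.submatrix_apply, charmatrix_apply_ne _ _ _ he] at h1
      rw [hadjA]
      refine ⟨he, fun h0 => h1 ?_⟩
      rw [h0]; simp)
  have hunit : IsUnit (∏ v : {v : S // ¬ τ v = ι v}, B v v) := by
    rw [IsUnit.prod_univ_iff]
    rintro ⟨v, hv⟩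
    have h1 := (hadjA _ _).mp ((hτadj v).resolve_left hv)
    rw [hB, Matrix.submatrix_apply, charmatrix_apply_ne _ _ _ h1.1]
    exact (Polynomial.isUnit_C.mpr (isUnit_iff_ne_zero.mpr h1.2)).neg
  let e0 : {v : S // τ v = ι v} → {v : Fin n // v ∉ U} := fun v => ⟨v.1.1, (hfix v.1).mp v.2⟩
  have he0 : Function.Bijective e0 := by
    constructor
    · intro a b h
      apply Subtype.ext; apply Subtype.ext
      exact congrArg (fun x : {v : Fin n // v ∉ U} => (x : Fin n)) h
    · rintro ⟨v, hv⟩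
      have hvS : v ∉ Finset.univ.image i := by
        intro h
        obtain ⟨s, _, rfl⟩ := Finset.mem_image.mp h
        exact hv (hiU s)
      exact ⟨⟨⟨v, hvS⟩, (hfix ⟨v, hvS⟩).mpr hv⟩, rfl⟩
  set M : Matrix {v : Fin n // v ∉ U} {v : Fin n // v ∉ U} ℝ[X] :=
    (charmatrix A).submatrix (fun a => (a : Fin n)) (fun a => (a : Fin n)) with hM
  have hblock : (B.toSquareBlockProp (fun v => τ v = ι v)).det = M.det := by
    rw [← Matrix.det_submatrix_equiv_self (Equiv.ofBijective e0 he0) M]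
    congr 1
    ext1 a b
    simp only [Matrix.toSquareBlockProp_def, Matrix.of_apply, hB, hM, Matrix.submatrix_apply,
      Equiv.ofBijective_apply]
    rw [b.2]
  rw [hblock] at hdet
  have hBM : ∀ f : ℝ[X], f ∣ B.det → f ∣ M.det := by
    intro f hf
    rw [hdet] at hf
    exact (hunit.dvd_mul_right).mp hf
  have hMc : M.det = (A.submatrix (fun a : {v : Fin n // v ∉ U} => (a : Fin n))
      (fun a : {v : Fin n // v ∉ U} => (a : Fin n))).charpoly := by
    rw [Matrix.charpoly]
    congr 1
    ext1 a b
    by_cases hab : a = b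
    · subst hab; simp [hM, charmatrix_apply_eq]
    · have : (a : Fin n) ≠ b := fun h => hab (Subtype.ext h)
      simp [hM, charmatrix_apply_ne _ _ _ hab, charmatrix_apply_ne _ _ _ this]
  have hdvd : detDivisor (charmatrix A) (n - k) ∣ M.det := by
    apply hBM
    let e : Fin (n - k) ≃ S := (Fintype.equivFinOfCardEq hScard).symm
    rw [← Matrix.det_submatrix_equiv_self e B]
    have := aux_gcd (charmatrix A) (n - k) (ι ∘ e) (τ ∘ e)
    rw [hB, Matrix.submatrix_submatrix]
    exact this
  refine ⟨hdvd, ?_, ?_⟩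
  · refine (Polynomial.natDegree_le_of_dvd hdvd ?_).trans ?_
    · rw [hMc]; exact (Matrix.charpoly_monic _).ne_zero
    · rw [hMc, Matrix.charpoly_natDegree_eq_dim]
      have := Fintype.card_subtype_compl (fun v : Fin n => v ∈ U)
      rw [Fintype.card_fin, Fintype.card_coe, hcover] at this
      have h2 : Fintype.card {v : Fin n // v ∉ U} = n - (n - t) := by convert this
      omega
  · intro lam hlam
    rw [Polynomial.le_rootMultiplicity_iff (Matrix.charpoly_monic _).ne_zero, ← hMc]
    apply hBM
    apply aux_dvd_det
    have h1 : B.map (Polynomial.eval lam) = (Matrix.scalar (Fin n) lam - A).submatrix ι τ := by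
      ext1 a b
      simp only [hB, Matrix.map_apply, Matrix.submatrix_apply, charmatrix_apply, Matrix.sub_apply,
        Matrix.scalar_apply, Matrix.diagonal_apply]
      split_ifs <;> simp
    have h2 := aux_rank_submatrix (Matrix.scalar (Fin n) lam - A) ι τ
    have h3 := aux_rank A hA lam
    rw [h1, hScard]
    omega
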